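/- (Hahn's ergodicity criterion, unipotent case) Let J be a unipotent integer matrix acting on 𝕋^d and c ∈ 𝕋^d, S(x) = Jx + c. Then S is ergodic with respect to Haar measure if and only if for every nontrivial character χ of 𝕋^d with χ∘J = χ, we have χ(c) ≠ 1. -/

import Mathlib

open Filter MeasureTheory Topology

/-- The affine map `x ↦ Jx + c` of the torus `𝕋^d`. -/
noncomputable def torusAffine {d : ℕ} (J : Matrix (Fin d) (Fin d) ℤ)
    (c : Fin d → AddCircle (1 : ℝ)) :
    (Fin d → AddCircle (1 : ℝ)) → (Fin d → AddCircle (1 : ℝ)) :=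
  fun x i => (∑ j, J i j • x j) + c i

open scoped Matrix

namespace TorusAffine

section UnipotentMatrix

open Polynomial in
/-- Modulo a power of `X - 1`, a nonzero integer multiple of `X - 1` is divisible by `X ^ k - 1`. -/
lemma exists_X_sub_one_mul_pow_eq (n k : ℕ) :
    ∃ W A : ℤ[X], (X - 1) * (k : ℤ[X]) ^ n = (X ^ k - 1) * W + (X - 1) ^ n * A := by
  set U : ℤ[X] := ∑ i ∈ Finset.range k, X ^ i with hU
  have hUX : (X - 1) * U = X ^ k - 1 := mul_geom_sum X k
  obtain ⟨V, hV⟩ : (X - 1 : ℤ[X]) ∣ (k : ℤ[X]) - U := by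
    have h : (X - C 1 : ℤ[X]) ∣ (k : ℤ[X]) - U := by
      rw [dvd_iff_isRoot]
      simp [hU, eval_finsetSum]
    simpa using h
  obtain ⟨W, hW⟩ : U ∣ (k : ℤ[X]) ^ n - ((k : ℤ[X]) - U) ^ n := by
    simpa using sub_dvd_pow_sub_pow (k : ℤ[X]) ((k : ℤ[X]) - U) n
  refine ⟨W, (X - 1) * V ^ n, ?_⟩
  rw [hV, mul_pow] at hW
  linear_combination (X - 1) * hW + W * hUX

/-- A vector that is periodic under a unipotent integer matrix is fixed by it. -/
lemma vecMul_eq_self_of_vecMul_pow_eq_self {ι : Type*} [Fintype ι] [DecidableEq ι]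
    {J : Matrix ι ι ℤ} {n k : ℕ} (hJ : (J - 1) ^ n = 0) (hk : k ≠ 0) {m : ι → ℤ}
    (hm : m ᵥ* J ^ k = m) : m ᵥ* J = m := by
  obtain ⟨W, A, h⟩ := exists_X_sub_one_mul_pow_eq n k
  replace h := congrArg (Polynomial.aeval J) h
  simp only [map_mul, map_sub, Polynomial.aeval_X, map_one, map_pow, map_natCast, map_add, hJ,
    zero_mul, add_zero] at h
  have h0 : m ᵥ* ((J - 1) * (k : Matrix ι ι ℤ) ^ n) = 0 := by
    rw [h, ← Matrix.vecMul_vecMul, Matrix.vecMul_sub, hm, Matrix.vecMul_one, sub_self,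
      Matrix.zero_vecMul]
  have h1 : (k ^ n) • (m ᵥ* (J - 1)) = 0 := by
    rw [← h0, ← Nat.cast_pow, ← nsmul_eq_mul', Matrix.vecMul_smul]
  rw [smul_eq_zero_iff_right (pow_ne_zero _ hk), Matrix.vecMul_sub, Matrix.vecMul_one,
    sub_eq_zero] at h1
  exact h1

lemma isUnit_of_sub_one_pow_eq_zero {R : Type*} [Ring R] {a : R} {n : ℕ}
    (ha : (a - 1) ^ n = 0) : IsUnit a := by
  simpa using IsNilpotent.isUnit_add_one ⟨n, ha⟩

end UnipotentMatrix

section Characters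

open UnitAddTorus

lemma mFourier_apply_eq_toCircle {ι : Type*} [Fintype ι] (m : ι → ℤ) (x : UnitAddTorus ι) :
    mFourier m x = (AddCircle.toCircle (∑ i, m i • x i) : ℂ) := by
  classical
  have h (s : Finset ι) :
      ∏ i ∈ s, fourier (m i) (x i) = (AddCircle.toCircle (∑ i ∈ s, m i • x i) : ℂ) := by
    induction s using Finset.induction_on with
    | empty => simp
    | insert i s hi ih =>
      rw [Finset.prod_insert hi, Finset.sum_insert hi, ih, AddCircle.toCircle_add, fourier_apply,
        Circle.coe_mul]
  exact h Finset.univ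

variable {d : ℕ} (J K : Matrix (Fin d) (Fin d) ℤ) (c x : Fin d → AddCircle (1 : ℝ))

lemma mFourier_torusAffine (m : Fin d → ℤ) :
    mFourier m (torusAffine J c x) = mFourier m c * mFourier (m ᵥ* J) x := by
  simp only [mFourier_apply_eq_toCircle, ← Circle.coe_mul, ← AddCircle.toCircle_add]
  congr 2
  simp only [torusAffine, smul_add, Finset.sum_add_distrib, Matrix.vecMul, dotProduct,
    Finset.smul_sum, Finset.sum_smul, mul_smul]
  rw [Finset.sum_comm, add_comm]

lemma continuous_torusAffine : Continuous (torusAffine J c) := by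
  unfold torusAffine
  fun_prop

lemma torusAffine_one_zero : torusAffine (1 : Matrix (Fin d) (Fin d) ℤ) 0 x = x := by
  ext i
  simp [torusAffine, Matrix.one_apply, ite_smul]

lemma torusAffine_mul_zero :
    torusAffine (J * K) 0 x = torusAffine J 0 (torusAffine K 0 x) := by
  ext i
  simp only [torusAffine, Matrix.mul_apply, Finset.smul_sum, Finset.sum_smul, mul_smul,
    Pi.zero_apply, add_zero]
  exact Finset.sum_comm

lemma torusAffine_zero_add (y : Fin d → AddCircle (1 : ℝ)) :
    torusAffine J 0 (x + y) = torusAffine J 0 x + torusAffine J 0 y := by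
  ext i
  simp [torusAffine, Finset.sum_add_distrib]

end Characters

section Ergodicity

open UnitAddTorus

/-- The probability Haar measure on the circle, as in `Mathlib.Analysis.Fourier.AddCircleMulti`. -/
noncomputable local instance measureSpaceUnitAddCircle : MeasureSpace UnitAddCircle := ⟨AddCircle.haarAddCircle⟩

local instance isAddHaarMeasure_volume :
    Measure.IsAddHaarMeasure (volume : Measure UnitAddCircle) :=
  inferInstanceAs (Measure.IsAddHaarMeasure AddCircle.haarAddCircle)

local instance isProbabilityMeasure_volume :
    IsProbabilityMeasure (volume : Measure UnitAddCircle) :=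
  inferInstanceAs (IsProbabilityMeasure AddCircle.haarAddCircle)

variable {d : ℕ} {J : Matrix (Fin d) (Fin d) ℤ} {c : UnitAddTorus (Fin d)}

lemma measurePreserving_torusAffine (hJ : IsUnit J) (c : UnitAddTorus (Fin d)) :
    MeasurePreserving (torusAffine J c) (volume : Measure (UnitAddTorus (Fin d))) volume := by
  let φ : UnitAddTorus (Fin d) →+ UnitAddTorus (Fin d) :=
    AddMonoidHom.mk' (torusAffine J 0) (torusAffine_zero_add J)
  have hφ : Function.Surjective φ := fun y => by
    obtain ⟨K, hK⟩ := hJ.exists_right_inv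
    refine ⟨torusAffine K 0 y, ?_⟩
    change torusAffine J 0 (torusAffine K 0 y) = y
    rw [← torusAffine_mul_zero, hK, torusAffine_one_zero]
  have h := (measurePreserving_add_right (volume : Measure (UnitAddTorus (Fin d))) c).comp
    (φ.measurePreserving (μ := volume) (ν := volume) (continuous_torusAffine J 0) hφ (by simp))
  convert h using 1
  ext x i
  simp [φ, torusAffine]

lemma mFourierCoeff_of_comp_torusAffine_eq (hJ : IsUnit J) {f : UnitAddTorus (Fin d) → ℂ}
    (hf : StronglyMeasurable f) (hfS : f ∘ torusAffine J c = f) (m : Fin d → ℤ) :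
    mFourierCoeff f m = mFourier (-m) c * mFourierCoeff f (m ᵥ* J) := by
  have hS := measurePreserving_torusAffine hJ c
  have h : mFourierCoeff f m =
      ∫ x, mFourier (-m) (torusAffine J c x) • f (torusAffine J c x) := by
    rw [mFourierCoeff]
    conv_lhs => rw [← hS.map_eq]
    refine integral_map hS.aemeasurable ?_
    exact ((mFourier (-m)).continuous.stronglyMeasurable.smul hf).aestronglyMeasurable
  rw [h, mFourierCoeff, ← integral_const_mul]
  refine integral_congr_ae (ae_of_all _ fun x => ?_)
  have hx : f (torusAffine J c x) = f x := congrFun hfS x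
  simp only [hx, mFourier_torusAffine, Matrix.neg_vecMul, smul_eq_mul, mul_assoc]

lemma norm_mFourier_apply (m : Fin d → ℤ) (x : UnitAddTorus (Fin d)) : ‖mFourier m x‖ = 1 := by
  rw [mFourier_apply_eq_toCircle, Circle.norm_coe]

/-- A square summable family whose norm is invariant under a unipotent integer matrix is supported
on the fixed vectors of the matrix. -/
lemma vecMul_eq_self_of_summable_of_ne_zero {n : ℕ} (hJ : (J - 1) ^ n = 0)
    {a : (Fin d → ℤ) → ℂ} (ha : Summable fun m => ‖a m‖ ^ 2)
    (haJ : ∀ m, ‖a (m ᵥ* J)‖ = ‖a m‖) {m : Fin d → ℤ} (hm : a m ≠ 0) : m ᵥ* J = m := by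
  have hpow (k : ℕ) : ‖a (m ᵥ* J ^ k)‖ = ‖a m‖ := by
    induction k with
    | zero => simp
    | succ k ih => rw [pow_succ, ← Matrix.vecMul_vecMul, haJ, ih]
  have hinj : ¬ Function.Injective fun k : ℕ => m ᵥ* J ^ k := fun hinj => by
    have h := ha.comp_injective hinj
    simp only [Function.comp_def, hpow, summable_const_iff] at h
    exact hm (by simpa using h)
  have hunit := isUnit_of_sub_one_pow_eq_zero hJ
  obtain ⟨i, k, hk, h⟩ : ∃ i k : ℕ, k ≠ 0 ∧ m ᵥ* J ^ (k + i) = m ᵥ* J ^ i := by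
    simp only [Function.Injective, not_forall] at hinj
    obtain ⟨p, q, hpq, hne⟩ := hinj
    rcases lt_or_gt_of_ne hne with hlt | hlt
    · exact ⟨p, q - p, by lia, by rw [Nat.sub_add_cancel hlt.le]; exact hpq.symm⟩
    · exact ⟨q, p - q, by lia, by rw [Nat.sub_add_cancel hlt.le]; exact hpq⟩
  refine vecMul_eq_self_of_vecMul_pow_eq_self hJ hk ?_
  rw [pow_add, ← Matrix.vecMul_vecMul] at h
  exact Matrix.vecMul_injective_of_isUnit (hunit.pow i) h

lemma ae_eq_const_of_mFourierCoeff_eq_zero {f : Lp ℂ 2 (volume : Measure (UnitAddTorus (Fin d)))}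
    (hf : ∀ m, m ≠ 0 → mFourierCoeff f m = 0) : ∃ b : ℂ, f =ᵐ[volume] fun _ => b := by
  have h := (hasSum_mFourier_series_L2 f).unique
    (hasSum_single 0 fun m hm => by rw [hf m hm, zero_smul])
  refine ⟨mFourierCoeff f 0, ?_⟩
  nth_rewrite 1 [h]
  filter_upwards [Lp.coeFn_smul (mFourierCoeff f 0) (mFourierLp 2 (0 : Fin d → ℤ)),
    coeFn_mFourierLp 2 (0 : Fin d → ℤ)] with x hx hx'
  rw [hx, Pi.smul_apply, hx', mFourier_zero, ContinuousMap.one_apply, smul_eq_mul, mul_one]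

lemma ergodic_torusAffine {n : ℕ} (hJ : (J - 1) ^ n = 0)
    (hc : ∀ m : Fin d → ℤ, m ≠ 0 → m ᵥ* J = m → mFourier m c ≠ 1) :
    Ergodic (torusAffine J c) (volume : Measure (UnitAddTorus (Fin d))) := by
  have hunit := isUnit_of_sub_one_pow_eq_zero hJ
  refine { measurePreserving_torusAffine hunit c with aeconst_set := fun s hs hsS => ?_ }
  let f : UnitAddTorus (Fin d) → ℂ := s.indicator fun _ => 1
  let F : Lp ℂ 2 (volume : Measure (UnitAddTorus (Fin d))) :=
    indicatorConstLp 2 hs (measure_ne_top _ _) 1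
  have hFf : F =ᵐ[volume] f := indicatorConstLp_coeFn
  have hfS : f ∘ torusAffine J c = f := by
    change (s.indicator fun _ => (1 : ℂ)) ∘ torusAffine J c = s.indicator fun _ => (1 : ℂ)
    conv_rhs => rw [← hsS]
    rfl
  have hcoeff (m : Fin d → ℤ) :
      mFourierCoeff F m = mFourier (-m) c * mFourierCoeff F (m ᵥ* J) := by
    have hFf' (k : Fin d → ℤ) : mFourierCoeff F k = mFourierCoeff f k :=
      integral_congr_ae (hFf.mono fun x hx => by simp only [hx])
    rw [hFf', hFf']
    exact mFourierCoeff_of_comp_torusAffine_eq hunit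
      (stronglyMeasurable_const.indicator hs) hfS m
  have hzero (m : Fin d → ℤ) (hm : m ≠ 0) : mFourierCoeff F m = 0 := by
    by_contra hne
    have hfix := vecMul_eq_self_of_summable_of_ne_zero hJ (hasSum_sq_mFourierCoeff F).summable
      (fun k => by rw [hcoeff k, norm_mul, norm_mFourier_apply, one_mul]) hne
    refine hc (-m) (neg_ne_zero.mpr hm) (by rw [Matrix.neg_vecMul, hfix]) ?_
    have h := hcoeff m
    rw [hfix] at h
    exact (right_eq_mul₀ hne).mp h
  obtain ⟨b, hb⟩ := ae_eq_const_of_mFourierCoeff_eq_zero hzero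
  rw [eventuallyConst_set]
  have hfb := hFf.symm.trans hb
  by_cases hb1 : b = 1
  · left
    filter_upwards [hfb] with x hx
    by_contra hxs
    simp [f, hxs, hb1] at hx
  · right
    filter_upwards [hfb] with x hx hxs
    exact hb1 (by simpa [f, hxs] using hx.symm)

lemma integral_mFourier_eq_zero {m : Fin d → ℤ} (hm : m ≠ 0) :
    ∫ x : UnitAddTorus (Fin d), mFourier m x = 0 := by
  have h := (orthonormal_mFourier (d := Fin d)).inner_eq_zero hm.symm
  rw [ContinuousMap.inner_toLp] at h
  simpa [mFourier_zero] using h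

lemma mFourier_ne_one_of_ergodic
    (hS : Ergodic (torusAffine J c) (volume : Measure (UnitAddTorus (Fin d)))) {m : Fin d → ℤ}
    (hm : m ≠ 0) (hmJ : m ᵥ* J = m) : mFourier m c ≠ 1 := fun h1 => by
  have hinv : mFourier m ∘ torusAffine J c = mFourier m := by
    ext x
    rw [Function.comp_apply, mFourier_torusAffine, hmJ, h1, one_mul]
  obtain ⟨b, hb⟩ := hS.ae_eq_const_of_ae_eq_comp_ae
    (mFourier m).continuous.aestronglyMeasurable hinv.eventuallyEq
  have hb0 : b = 0 := by
    have h := integral_congr_ae hb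
    simpa [integral_mFourier_eq_zero hm] using h.symm
  obtain ⟨x, hx⟩ := hb.exists
  simpa [hx, hb0] using norm_mFourier_apply m x

/-- Hahn's criterion for the product of the probability Haar measures. -/
theorem ergodic_torusAffine_iff (hJ : ∃ n : ℕ, (J - 1) ^ n = 0) :
    Ergodic (torusAffine J c) (volume : Measure (UnitAddTorus (Fin d))) ↔
      ∀ m : Fin d → ℤ, m ≠ 0 → m ᵥ* J = m → mFourier m c ≠ 1 := by
  obtain ⟨n, hn⟩ := hJ
  exact ⟨fun h _ hm hmJ => mFourier_ne_one_of_ergodic h hm hmJ, ergodic_torusAffine hn⟩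

end Ergodicity

lemma volume_eq_pi_haarAddCircle (d : ℕ) :
    (volume : Measure (Fin d → AddCircle (1 : ℝ))) =
      Measure.pi fun _ => AddCircle.haarAddCircle := by
  rw [volume_pi]
  simp [AddCircle.volume_eq_smul_haarAddCircle]

end TorusAffine

/-- Hahn's ergodicity criterion, unipotent case: for a unipotent integer matrix `J`
and `c ∈ 𝕋^d`, the affine map `S(x) = Jx + c` is ergodic for Haar measure if and only
if every nontrivial character `χ(x) = e^{2πi m·x}` (`m ∈ ℤ^d`, `m ≠ 0`) satisfying
`χ ∘ J = χ` (i.e. `Jᵀm = m`) has `χ(c) ≠ 1`. -/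
theorem stmt_10 {d : ℕ} (J : Matrix (Fin d) (Fin d) ℤ)
    (hJ : ∃ n : ℕ, (J - 1) ^ n = 0) (c : Fin d → AddCircle (1 : ℝ)) :
    Ergodic (torusAffine J c) ↔
      ∀ m : Fin d → ℤ, m ≠ 0 → (∀ j, ∑ i, m i * J i j = m j) →
        (AddCircle.toCircle (∑ i, m i • c i) : ℂ) ≠ 1 := by
  rw [TorusAffine.volume_eq_pi_haarAddCircle]
  refine (TorusAffine.ergodic_torusAffine_iff hJ).trans ?_
  simp only [TorusAffine.mFourier_apply_eq_toCircle, funext_iff, Matrix.vecMul, dotProduct]
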